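/- Let ρ : ℝ × ℝ³ → ℝ and J : ℝ × ℝ³ → ℝ³ be smooth with compact support, satisfying the continuity equation ∂ρ/∂t + div J = 0 everywhere. Define the retarded potentials V(t, x) = (1/(4πε₀)) ∫_{ℝ³} ρ(t − |x − y|/c, y)/|x − y| dy and A(t, x) = (μ₀/(4π)) ∫_{ℝ³} J(t − |x − y|/c, y)/|x − y| dy. Then V and A satisfy the Lorentz gauge condition div A + μ₀ε₀ ∂V/∂t = 0 everywhere. -/

import Mathlib

noncomputable section

open Real MeasureTheory Filter

/-- Physical space `ℝ³`. -/
abbrev V3 : Type := Fin 3 → ℝ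

/-- Partial derivative with respect to the time variable. -/
def ptd {E : Type} [NormedAddCommGroup E] [NormedSpace ℝ E]
    (f : ℝ × V3 → E) : ℝ × V3 → E :=
  fun p => deriv (fun s => f (s, p.2)) p.1

/-- Partial derivative in the `i`-th spatial direction. -/
def pxd {E : Type} [NormedAddCommGroup E] [NormedSpace ℝ E]
    (i : Fin 3) (f : ℝ × V3 → E) : ℝ × V3 → E :=
  fun p => fderiv ℝ (fun y => f (p.1, y)) p.2 (Pi.single i (1 : ℝ))

/-- Spatial Laplacian. -/
def lap {E : Type} [NormedAddCommGroup E] [NormedSpace ℝ E]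
    (f : ℝ × V3 → E) : ℝ × V3 → E :=
  fun p => ∑ i : Fin 3, pxd i (pxd i f) p

/-- Spatial divergence of a vector field. -/
def divg (F : ℝ × V3 → V3) : ℝ × V3 → ℝ :=
  fun p => ∑ i : Fin 3, pxd i (fun q => F q i) p

/-- Spatial curl of a vector field. -/
def curl (F : ℝ × V3 → V3) : ℝ × V3 → V3 :=
  fun p => ![pxd 1 (fun q => F q 2) p - pxd 2 (fun q => F q 1) p,
             pxd 2 (fun q => F q 0) p - pxd 0 (fun q => F q 2) p,
             pxd 0 (fun q => F q 1) p - pxd 1 (fun q => F q 0) p]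

/-- Spatial gradient of a scalar field. -/
def grad (f : ℝ × V3 → ℝ) : ℝ × V3 → V3 :=
  fun p i => pxd i f p

/-- The d'Alembertian `□² = Δ - μ₀ε₀ ∂²/∂t²`. -/
def box (μ₀ ε₀ : ℝ) {E : Type} [NormedAddCommGroup E] [NormedSpace ℝ E]
    (f : ℝ × V3 → E) : ℝ × V3 → E :=
  fun p => lap f p - (μ₀ * ε₀) • ptd (ptd f) p

/-- Maxwell's equations for charge `ρ`, current `J` and fields `E`, `B`. -/
def Maxwell (ε₀ μ₀ : ℝ) (ρ : ℝ × V3 → ℝ) (J E B : ℝ × V3 → V3) : Prop :=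
  ∀ p : ℝ × V3,
    divg E p = ρ p / ε₀ ∧ divg B p = 0 ∧
    curl E p = -(ptd B p) ∧
    curl B p = μ₀ • J p + (μ₀ * ε₀) • ptd E p

/-- `f` is Schwartz in the spatial variable, locally uniformly in time. -/
def SchwartzLocUnif {E : Type} [NormedAddCommGroup E] [NormedSpace ℝ E]
    (f : ℝ × V3 → E) : Prop :=
  ∀ (α β : Fin 3 → ℕ) (j : ℕ) (R : ℝ), ∃ C : ℝ, ∀ p : ℝ × V3, |p.1| ≤ R →
    |∏ i : Fin 3, p.2 i ^ α i| *
      ‖(ptd^[j] ((pxd 0)^[β 0] ((pxd 1)^[β 1] ((pxd 2)^[β 2] f)))) p‖ ≤ C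

/-- Euclidean norm on `ℝ³`. -/
def norm3 (x : V3) : ℝ := Real.sqrt (∑ i : Fin 3, x i ^ 2)

/-- Dot product on `ℝ³`. -/
def dot3 (x y : V3) : ℝ := ∑ i : Fin 3, x i * y i

/-- Cross product on `ℝ³`. -/
def cross3 (a b : V3) : V3 :=
  ![a 1 * b 2 - a 2 * b 1, a 2 * b 0 - a 0 * b 2, a 0 * b 1 - a 1 * b 0]

/-- The Lorentz factor `γ_v`. -/
def gam (c : ℝ) (v : V3) : ℝ := 1 / Real.sqrt (1 - norm3 v ^ 2 / c ^ 2)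

/-- The Lorentz boost `Λ_v` with velocity `v`. -/
def boost (c : ℝ) (v : V3) (p : ℝ × V3) : ℝ × V3 :=
  (gam c v * (p.1 - dot3 v p.2 / c ^ 2),
   p.2 + ((gam c v - 1) * dot3 v p.2 / norm3 v ^ 2 - gam c v * p.1) • v)

/-- Transformed charge `ρ'_v`, i.e. the function with
`ρ'_v (Λ_v p) = γ_v (ρ p - v·J p / c²)`. -/
def rhoTr (c : ℝ) (v : V3) (ρ : ℝ × V3 → ℝ) (J : ℝ × V3 → V3) : ℝ × V3 → ℝ :=
  fun p => gam c v * (ρ (boost c (-v) p) - dot3 v (J (boost c (-v) p)) / c ^ 2)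

/-- Transformed current `J'_v`, i.e. the function with
`J'_v (Λ_v p) = J p + ((γ_v - 1)(v·J p)/|v|² - γ_v ρ p) v`. -/
def JTr (c : ℝ) (v : V3) (ρ : ℝ × V3 → ℝ) (J : ℝ × V3 → V3) : ℝ × V3 → V3 :=
  fun p => J (boost c (-v) p) +
    ((gam c v - 1) * dot3 v (J (boost c (-v) p)) / norm3 v ^ 2
      - gam c v * ρ (boost c (-v) p)) • v

/-- Transformed electric field `E''_v`, i.e. the function with
`E''_v (Λ_v p) = E_∥ p + γ_v E_⊥ p`. -/
def ETr (c : ℝ) (v : V3) (E : ℝ × V3 → V3) : ℝ × V3 → V3 :=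
  fun p =>
    (dot3 (E (boost c (-v) p)) v / norm3 v ^ 2) • v +
    gam c v • (E (boost c (-v) p) - (dot3 (E (boost c (-v) p)) v / norm3 v ^ 2) • v)

/-- Spatial gradient of a complex scalar field. -/
def gradC (f : ℝ × V3 → ℂ) : ℝ × V3 → Fin 3 → ℂ :=
  fun p i => pxd i f p

/-- Spatial divergence of a complex vector field. -/
def divgC (F : ℝ × V3 → Fin 3 → ℂ) : ℝ × V3 → ℂ :=
  fun p => ∑ i : Fin 3, pxd i (fun q => F q i) p

lemma continuous_norm3 : Continuous norm3 := by
  unfold norm3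
  fun_prop

lemma norm3_nonneg (x : V3) : 0 ≤ norm3 x := Real.sqrt_nonneg _

lemma norm_le_norm3 (x : V3) : ‖x‖ ≤ norm3 x := by
  refine (pi_norm_le_iff_of_nonneg (norm3_nonneg x)).2 fun i => ?_
  rw [Real.norm_eq_abs, ← Real.sqrt_sq_eq_abs]
  exact Real.sqrt_le_sqrt
    (Finset.single_le_sum (f := fun j => x j ^ 2) (fun j _ => sq_nonneg _) (Finset.mem_univ i))

/-- The Newtonian kernel is locally integrable on `ℝ³`. -/
lemma locallyIntegrable_inv_norm3 : LocallyIntegrable (fun z : V3 => (norm3 z)⁻¹) := by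
  refine locallyIntegrable_of_norm_le_rpow (C := 1) (α := 1) (by simp) (by simp) ?_
    continuous_norm3.measurable.inv.aestronglyMeasurable
  filter_upwards [Measure.ae_ne volume (0 : V3)] with z hz
  rw [Real.norm_of_nonneg (inv_nonneg.2 (norm3_nonneg z)), one_mul, Real.rpow_neg_one]
  exact inv_anti₀ (norm_pos_iff.2 hz) (norm_le_norm3 z)

/-- The map `z ↦ (|z| / c, z)` parametrizing the light cone. -/
def lightCone (c : ℝ) (z : V3) : ℝ × V3 := (norm3 z / c, z)

lemma continuous_lightCone (c : ℝ) : Continuous (lightCone c) := by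
  have := continuous_norm3
  unfold lightCone
  fun_prop

section RetardedIntegral

variable {E : Type} [NormedAddCommGroup E] [NormedSpace ℝ E]

/-- Bound, uniform for `p` in a ball, of the retarded integrand by an integrable function. -/
lemma exists_integrable_bound_retarded (c : ℝ) {g : ℝ × V3 → E} (hg : Continuous g)
    (hs : HasCompactSupport g) (p₀ : ℝ × V3) :
    ∃ b : V3 → ℝ, Integrable b ∧ ∀ z, ∀ p ∈ Metric.ball p₀ 1,
      ‖(norm3 z)⁻¹ • g (p - lightCone c z)‖ ≤ b z := by
  obtain ⟨C, hC⟩ := hs.exists_bound_of_continuous hg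
  obtain ⟨R, hR⟩ := hs.isCompact.isBounded.subset_closedBall 0
  let K : Set V3 := Metric.closedBall 0 (R + ‖p₀‖ + 1)
  have hK : IsCompact K := isCompact_closedBall _ _
  refine ⟨K.indicator fun z => (norm3 z)⁻¹ * C, ?_, fun z p hp => ?_⟩
  · rw [integrable_indicator_iff hK.measurableSet]
    exact (locallyIntegrable_inv_norm3.integrableOn_isCompact hK).mul_const C
  · by_cases hz : z ∈ K
    · rw [Set.indicator_of_mem hz, norm_smul,
        Real.norm_of_nonneg (inv_nonneg.2 (norm3_nonneg z))]
      exact mul_le_mul_of_nonneg_left (hC _) (inv_nonneg.2 (norm3_nonneg z))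
    · have h0 : g (p - lightCone c z) = 0 := by
        refine image_eq_zero_of_notMem_tsupport fun hmem => hz ?_
        have h1 : ‖p - lightCone c z‖ ≤ R := by simpa using hR hmem
        have h2 : ‖p.2 - z‖ ≤ ‖p - lightCone c z‖ := norm_snd_le (p - lightCone c z)
        have h3 : ‖p.2‖ ≤ ‖p‖ := norm_snd_le p
        have h4 : ‖p - p₀‖ < 1 := by simpa [dist_eq_norm] using hp
        have h5 := norm_sub_norm_le p p₀
        have h6 := norm_sub_norm_le z p.2
        rw [norm_sub_rev] at h6
        simp only [K, mem_closedBall_zero_iff]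
        linarith
      rw [Set.indicator_of_notMem hz, h0, smul_zero, norm_zero]

lemma aestronglyMeasurable_retarded (c : ℝ) {g : ℝ × V3 → E} (hg : Continuous g) (p : ℝ × V3) :
    AEStronglyMeasurable (fun z : V3 => (norm3 z)⁻¹ • g (p - lightCone c z)) := by
  have := continuous_lightCone c
  exact continuous_norm3.measurable.inv.aestronglyMeasurable.smul
    (by fun_prop : Continuous fun z : V3 => g (p - lightCone c z)).aestronglyMeasurable

lemma integrable_retarded (c : ℝ) {g : ℝ × V3 → E} (hg : Continuous g)
    (hs : HasCompactSupport g) (p : ℝ × V3) :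
    Integrable fun z : V3 => (norm3 z)⁻¹ • g (p - lightCone c z) := by
  obtain ⟨b, hb, hle⟩ := exists_integrable_bound_retarded c hg hs p
  exact hb.mono' (aestronglyMeasurable_retarded c hg p)
    (Eventually.of_forall fun z => hle z p (Metric.mem_ball_self one_pos))

/-- A retarded integral of a compactly supported `C¹` source may be differentiated under the
integral sign. -/
lemma hasFDerivAt_retarded (c : ℝ) {g : ℝ × V3 → E} (hg : ContDiff ℝ 1 g)
    (hs : HasCompactSupport g) (p : ℝ × V3) :
    HasFDerivAt (fun p => ∫ z : V3, (norm3 z)⁻¹ • g (p - lightCone c z))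
      (∫ z : V3, (norm3 z)⁻¹ • fderiv ℝ g (p - lightCone c z)) p := by
  have hg' := hg.continuous_fderiv one_ne_zero
  obtain ⟨b, hb, hle⟩ := exists_integrable_bound_retarded c hg' (hs.fderiv ℝ) p
  refine hasFDerivAt_integral_of_dominated_of_fderiv_le
    (F' := fun q z => (norm3 z)⁻¹ • fderiv ℝ g (q - lightCone c z))
    (Metric.ball_mem_nhds p one_pos)
    (Eventually.of_forall fun q => aestronglyMeasurable_retarded c hg.continuous q)
    (integrable_retarded c hg.continuous hs p) (aestronglyMeasurable_retarded c hg' p)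
    (Eventually.of_forall hle) hb (Eventually.of_forall fun z q _ => ?_)
  have h := (hg.differentiable one_ne_zero (q - lightCone c z)).hasFDerivAt.comp q
    ((hasFDerivAt_id q).sub_const (lightCone c z))
  exact h.const_smul _

end RetardedIntegral

lemma ptd_eq_fderiv {E : Type} [NormedAddCommGroup E] [NormedSpace ℝ E] {f : ℝ × V3 → E}
    {f' : ℝ × V3 →L[ℝ] E} {p : ℝ × V3} (h : HasFDerivAt f f' p) : ptd f p = f' (1, 0) :=
  (HasFDerivAt.comp_hasDerivAt (f := fun s => (s, p.2)) p.1 h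
    ((hasDerivAt_id p.1).prodMk (hasDerivAt_const p.1 p.2))).deriv

lemma pxd_eq_fderiv {E : Type} [NormedAddCommGroup E] [NormedSpace ℝ E] {f : ℝ × V3 → E}
    {f' : ℝ × V3 →L[ℝ] E} {p : ℝ × V3} (i : Fin 3) (h : HasFDerivAt f f' p) :
    pxd i f p = f' (0, Pi.single i 1) := by
  have h' := HasFDerivAt.comp (f := fun y => (p.1, y)) p.2 h (hasFDerivAt_prodMk_right p.1 p.2)
  exact congrArg (· (Pi.single i (1 : ℝ))) h'.fderiv

/-- Retarded integrals commute with directional derivatives. -/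
lemma integral_fderiv_retarded_apply (c : ℝ) {g : ℝ × V3 → ℝ} (hg : ContDiff ℝ 1 g)
    (hs : HasCompactSupport g) (p v : ℝ × V3) :
    (∫ z : V3, (norm3 z)⁻¹ • fderiv ℝ g (p - lightCone c z)) v =
      ∫ z : V3, (norm3 z)⁻¹ • fderiv ℝ g (p - lightCone c z) v :=
  ContinuousLinearMap.integral_apply
    (integrable_retarded c (hg.continuous_fderiv one_ne_zero) (hs.fderiv ℝ) p) v

/-- The change of variables `y = x - z` in a retarded integral. -/
lemma integral_retarded_eq {E : Type} [NormedAddCommGroup E] [NormedSpace ℝ E] (c : ℝ)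
    (g : ℝ × V3 → E) (p : ℝ × V3) :
    ∫ y : V3, (norm3 (p.2 - y))⁻¹ • g (p.1 - norm3 (p.2 - y) / c, y) =
      ∫ z : V3, (norm3 z)⁻¹ • g (p - lightCone c z) := by
  rw [← integral_sub_left_eq_self _ volume p.2]
  simp only [sub_sub_cancel]
  rfl

/-- the retarded potentials of a charge/current pair satisfying
the continuity equation satisfy the Lorentz gauge condition. -/
theorem stmt_2 (ε₀ μ₀ c : ℝ) (hε : 0 < ε₀) (hμ : 0 < μ₀)
    (hc : c = 1 / Real.sqrt (μ₀ * ε₀))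
    (ρ : ℝ × V3 → ℝ) (J : ℝ × V3 → V3)
    (hρ : ContDiff ℝ (⊤ : ℕ∞) ρ) (hJ : ContDiff ℝ (⊤ : ℕ∞) J)
    (hρsupp : HasCompactSupport ρ) (hJsupp : HasCompactSupport J)
    (hcont : ∀ p : ℝ × V3, ptd ρ p + divg J p = 0)
    (V : ℝ × V3 → ℝ) (A : ℝ × V3 → V3)
    (hV : V = fun p => (1 / (4 * Real.pi * ε₀)) *
      ∫ y : V3, ρ (p.1 - norm3 (p.2 - y) / c, y) / norm3 (p.2 - y))
    (hA : A = fun p => (μ₀ / (4 * Real.pi)) •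
      ∫ y : V3, (norm3 (p.2 - y))⁻¹ • J (p.1 - norm3 (p.2 - y) / c, y)) :
    ∀ p : ℝ × V3, divg A p + μ₀ * ε₀ * ptd V p = 0 := by
  intro p
  let Ji : Fin 3 → ℝ × V3 → ℝ := fun i q => J q i
  have hρ1 : ContDiff ℝ 1 ρ := hρ.of_le (by exact_mod_cast le_top)
  have hJ1 : ContDiff ℝ 1 J := hJ.of_le (by exact_mod_cast le_top)
  have hJi (i : Fin 3) : ContDiff ℝ 1 (Ji i) := contDiff_pi.1 hJ1 i
  have hJis (i : Fin 3) : HasCompactSupport (Ji i) :=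
    hJsupp.comp_left (g := fun v : V3 => v i) rfl
  have hV' : V = fun q => (1 / (4 * Real.pi * ε₀)) •
      ∫ z : V3, (norm3 z)⁻¹ • ρ (q - lightCone c z) := by
    rw [hV]
    funext q
    rw [← integral_retarded_eq, smul_eq_mul]
    simp only [smul_eq_mul, div_eq_inv_mul]
  have hA' (i : Fin 3) : (fun q => A q i) = fun q => (μ₀ / (4 * Real.pi)) •
      ∫ z : V3, (norm3 z)⁻¹ • Ji i (q - lightCone c z) := by
    rw [hA]
    funext q
    beta_reduce
    rw [integral_retarded_eq, Pi.smul_apply]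
    congr 1
    exact ((ContinuousLinearMap.proj (R := ℝ) (φ := fun _ : Fin 3 => ℝ) i).integral_comp_comm
      (integrable_retarded c hJ1.continuous hJsupp q)).symm
  have hVt : ptd V p = (1 / (4 * Real.pi * ε₀)) *
      ∫ z : V3, (norm3 z)⁻¹ • ptd ρ (p - lightCone c z) := by
    rw [hV', ptd_eq_fderiv ((hasFDerivAt_retarded c hρ1 hρsupp p).fun_const_smul _),
      _root_.smul_apply, integral_fderiv_retarded_apply c hρ1 hρsupp, smul_eq_mul]
    simp only [ptd_eq_fderiv (hρ1.differentiable one_ne_zero _).hasFDerivAt]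
  have hAx (i : Fin 3) : pxd i (fun q => A q i) p = (μ₀ / (4 * Real.pi)) *
      ∫ z : V3, (norm3 z)⁻¹ • pxd i (Ji i) (p - lightCone c z) := by
    rw [hA' i, pxd_eq_fderiv i ((hasFDerivAt_retarded c (hJi i) (hJis i) p).fun_const_smul _),
      _root_.smul_apply, integral_fderiv_retarded_apply c (hJi i) (hJis i),
      smul_eq_mul]
    simp only [pxd_eq_fderiv i ((hJi i).differentiable one_ne_zero _).hasFDerivAt]
  have hint (i : Fin 3) :
      Integrable fun z : V3 => (norm3 z)⁻¹ • pxd i (Ji i) (p - lightCone c z) := by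
    simp only [pxd_eq_fderiv i ((hJi i).differentiable one_ne_zero _).hasFDerivAt]
    exact (integrable_retarded c ((hJi i).continuous_fderiv one_ne_zero)
      ((hJis i).fderiv ℝ) p).apply_continuousLinearMap _
  have hsum : ∑ i, ∫ z : V3, (norm3 z)⁻¹ • pxd i (Ji i) (p - lightCone c z) =
      -∫ z : V3, (norm3 z)⁻¹ • ptd ρ (p - lightCone c z) := by
    rw [← integral_finsetSum _ fun i _ => hint i, ← integral_neg]
    congr 1
    funext z
    rw [← Finset.smul_sum, ← smul_neg]
    congr 1
    exact eq_neg_of_add_eq_zero_right (hcont (p - lightCone c z))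
  have hdiv : divg A p = ∑ i, pxd i (fun q => A q i) p := rfl
  rw [hdiv, Finset.sum_congr rfl fun i _ => hAx i, ← Finset.mul_sum, hsum, hVt]
  field_simp
  ring
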